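/- For the three-state fuzzy automaton A over the Goguen structure and one-letter alphabet {x} given in the context, the set {τ_u | u ∈ X*} ⊆ [0,1]^A has exactly three elements, namely (0,1,0), (0.5,1,1) and (1,1,1) (written as triples (τ_u(a₀), τ_u(a₁), τ_u(a₂))); consequently the reverse Nerode automaton of A is finite with exactly 3 states, even though the Nerode automaton of A is infinite. -/

import Mathlib

noncomputable section

/-- The fuzzy transition relation (for the unique letter `x`) of the example fuzzy
automaton over the Goguen (product) structure on `[0,1] ⊆ ℝ`: states `a₀, a₁, a₂` are
`0, 1, 2 : Fin 3`, and `δ(a₀,x,a₁) = 0.5`, `δ(a₀,x,a₂) = 1`, `δ(a₁,x,a₁) = 1`,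
`δ(a₂,x,a₁) = 1`, `δ(a₂,x,a₂) = 0.5`, all other values being `0`. -/
def del : Fin 3 → Fin 3 → ℝ := ![![0, 0.5, 1], ![0, 1, 0], ![0, 1, 0.5]]

/-- The fuzzy set of initial states `σ = (1,0,0)`. -/
def sig : Fin 3 → ℝ := ![1, 0, 0]

/-- The fuzzy set of terminal states `τ = (0,1,0)`. -/
def ter : Fin 3 → ℝ := ![0, 1, 0]

/-- Auxiliary: `δ*` processing the word from the right, so that after reversing it matches
`δ*(a,ε,b) = 1` if `a = b` and `0` otherwise, `δ*(a,ux,b) = ⨆ c, δ*(a,u,c) ⬝ δ(c,x,b)`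
(the one-letter alphabet is modeled by `Unit`, `⊗` is real multiplication and `⨆` is the
supremum over the three states). -/
def dstarAux (a : Fin 3) : List Unit → Fin 3 → ℝ
  | [], b => if a = b then 1 else 0
  | _ :: u, b => ⨆ c : Fin 3, dstarAux a u c * del c b

/-- The extension `δ*` of the transition relation of the example automaton. -/
def dstar (a : Fin 3) (u : List Unit) (b : Fin 3) : ℝ := dstarAux a u.reverse b

theorem iSup_fin3 (f : Fin 3 → ℝ) : (⨆ c : Fin 3, f c) = max (f 0) (max (f 1) (f 2)) := by
  apply le_antisymm
  · apply ciSup_le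
    intro c
    fin_cases c <;> simp
  · have hb : BddAbove (Set.range f) := (Set.finite_range f).bddAbove
    exact max_le (le_ciSup hb 0) (max_le (le_ciSup hb 1) (le_ciSup hb 2))

theorem aux_one (a : Fin 3) (u : Unit) (b : Fin 3) : dstarAux a [u] b = del a b := by
  simp only [dstarAux, iSup_fin3]
  fin_cases a <;> fin_cases b <;> simp [del] <;> norm_num

theorem aux_two (n : ℕ) : ∀ w : List Unit, w.length = n + 2 → ∀ a b,
    dstarAux a w b = (![![0, 1, (1/2 : ℝ) ^ (n+1)], ![0, 1, 0], ![0, 1, (1/2 : ℝ) ^ (n+2)]] :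
      Fin 3 → Fin 3 → ℝ) a b := by
  induction n with
  | zero =>
    intro w hw a b
    match w, hw with
    | [x, y], _ =>
      rw [dstarAux]
      simp only [aux_one, iSup_fin3]
      fin_cases a <;> fin_cases b <;> simp [del] <;> norm_num
  | succ n ih =>
    intro w hw a b
    match w, hw with
    | x :: u, hw =>
      rw [dstarAux]
      simp only [ih u (by simpa using hw), iSup_fin3]
      have h0 : (0 : ℝ) < (1/2 : ℝ) ^ n := by positivity
      have h1 : (1/2 : ℝ) ^ n ≤ 1 := pow_le_one₀ (by norm_num) (by norm_num)
      fin_cases a <;> fin_cases b <;> simp [del, pow_succ] <;>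
        (simp only [one_div, inv_pow] at h0 h1; grind)

theorem tau_nil : (fun a : Fin 3 => ⨆ b : Fin 3, dstar a [] b * ter b) = ![0, 1, 0] := by
  funext a
  simp only [iSup_fin3, dstar, List.reverse_nil, dstarAux]
  fin_cases a <;> simp [ter] <;> norm_num

theorem tau_one (x : Unit) :
    (fun a : Fin 3 => ⨆ b : Fin 3, dstar a [x] b * ter b) = ![0.5, 1, 1] := by
  funext a
  simp only [iSup_fin3, dstar, List.reverse_singleton, aux_one]
  fin_cases a <;> simp [ter, del] <;> norm_num

theorem tau_two (n : ℕ) (w : List Unit) (hw : w.length = n + 2) :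
    (fun a : Fin 3 => ⨆ b : Fin 3, dstar a w b * ter b) = ![1, 1, 1] := by
  funext a
  simp only [iSup_fin3, dstar, aux_two n w.reverse (by simpa using hw)]
  fin_cases a <;> simp [ter] <;> norm_num

theorem tau_set : {g : Fin 3 → ℝ |
        ∃ u : List Unit, g = fun a : Fin 3 => ⨆ b : Fin 3, dstar a u b * ter b}
      = {![0, 1, 0], ![0.5, 1, 1], ![1, 1, 1]} := by
  ext g
  simp only [Set.mem_ofPred_eq, Set.mem_insert_iff, Set.mem_singleton_iff]
  constructor
  · rintro ⟨u, rfl⟩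
    match u with
    | [] => exact Or.inl tau_nil
    | [x] => exact Or.inr (Or.inl (tau_one x))
    | x :: y :: v => exact Or.inr (Or.inr (tau_two v.length _ (by simp)))
  · rintro (rfl | rfl | rfl)
    · exact ⟨[], tau_nil.symm⟩
    · exact ⟨[()], (tau_one ()).symm⟩
    · exact ⟨[(), ()], (tau_two 0 _ (by simp)).symm⟩

theorem sigma_infinite : {g : Fin 3 → ℝ |
      ∃ u : List Unit, g = fun a : Fin 3 => ⨆ b : Fin 3, sig b * dstar b u a}.Infinite := by
  apply Set.infinite_of_injective_forall_mem
    (f := fun n : ℕ => fun a : Fin 3 =>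
      ⨆ b : Fin 3, sig b * dstar b (List.replicate (n + 2) ()) a)
  · intro m n h
    have h2 := congrFun h 2
    simp only [iSup_fin3, dstar, aux_two m (List.replicate (m + 2) ()).reverse (by simp),
      aux_two n (List.replicate (n + 2) ()).reverse (by simp)] at h2
    have hm : (0 : ℝ) ≤ (2 ^ (m+1))⁻¹ := by positivity
    have hn : (0 : ℝ) ≤ (2 ^ (n+1))⁻¹ := by positivity
    simpa [sig, hm, hn] using h2
  · intro n
    exact ⟨_, rfl⟩

/-- For the three-state example fuzzy automaton over the Goguen
structure and the one-letter alphabet `{x}`, the set `{τ_u | u ∈ X*}` (the state set of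
the reverse Nerode automaton, where `τ_u(a) = ⨆ b, δ*(a,u,b) ⊗ τ(b)`) has exactly three
elements, namely `(0,1,0)`, `(0.5,1,1)` and `(1,1,1)`; consequently the reverse Nerode
automaton of the automaton is finite with exactly `3` states, even though the Nerode
automaton (with state set `{σ_u | u ∈ X*}`) is infinite. -/
theorem example_reverse_nerode_three_states :
    ({g : Fin 3 → ℝ |
        ∃ u : List Unit, g = fun a : Fin 3 => ⨆ b : Fin 3, dstar a u b * ter b}
      = {![0, 1, 0], ![0.5, 1, 1], ![1, 1, 1]}) ∧
    ({g : Fin 3 → ℝ |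
        ∃ u : List Unit, g = fun a : Fin 3 => ⨆ b : Fin 3, dstar a u b * ter b}.ncard = 3) ∧
    {g : Fin 3 → ℝ |
      ∃ u : List Unit, g = fun a : Fin 3 => ⨆ b : Fin 3, sig b * dstar b u a}.Infinite := by
  refine ⟨tau_set, ?_, sigma_infinite⟩
  rw [tau_set, Set.ncard_eq_three]
  refine ⟨_, _, _, ?_, ?_, ?_, rfl⟩
  · intro h
    have := congrFun h 0
    norm_num at this
  · intro h
    have := congrFun h 0
    norm_num at this
  · intro h
    have := congrFun h 0
    norm_num at this

end
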